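/- arXiv:2406.11841 — 6 statements merged into one kernel-verified Lean document; each statement's English description precedes it below -/
import Mathlib

section
/- Let A be an n-dimensional bicommutative algebra over ℂ with dim Ann(A) = s ≠ 0. Then the quotient A' = A/Ann(A) is an (n−s)-dimensional bicommutative algebra, and there exists a cocycle θ ∈ Z²(A', ℂ^s) with Ann(A') ∩ Ann(θ) = 0 such that A is isomorphic as a ℂ-algebra to the central extension A'_θ. -/
/-- Bicommutativity of a bilinear multiplication: `(xy)z = (xz)y` and `x(yz) = y(xz)`. -/
def IsBicommutative {A : Type*} [AddCommGroup A] [Module ℂ A]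
    (m : A →ₗ[ℂ] A →ₗ[ℂ] A) : Prop :=
  (∀ x y z : A, m (m x y) z = m (m x z) y) ∧ (∀ x y z : A, m x (m y z) = m y (m x z))

/-- The cocycle condition for a bilinear map `θ : A × A → V`. -/
def IsCocycle {A V : Type*} [AddCommGroup A] [Module ℂ A] [AddCommGroup V] [Module ℂ V]
    (m : A →ₗ[ℂ] A →ₗ[ℂ] A) (θ : A →ₗ[ℂ] A →ₗ[ℂ] V) : Prop :=
  (∀ x y z : A, θ (m x y) z = θ (m x z) y) ∧ (∀ x y z : A, θ x (m y z) = θ y (m x z))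

/-- The central extension product on `A × V`. -/
noncomputable def extMul {A V : Type*} [AddCommGroup A] [Module ℂ A] [AddCommGroup V] [Module ℂ V]
    (m : A →ₗ[ℂ] A →ₗ[ℂ] A) (θ : A →ₗ[ℂ] A →ₗ[ℂ] V) :
    (A × V) →ₗ[ℂ] (A × V) →ₗ[ℂ] (A × V) :=
  LinearMap.mk₂ ℂ (fun p q => (m p.1 q.1, θ p.1 q.1))
    (fun p p' q => by simp [Prod.ext_iff])
    (fun c p q => by simp [Prod.ext_iff])
    (fun p q q' => by simp [Prod.ext_iff])
    (fun c p q => by simp [Prod.ext_iff])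

/-- The annihilator `Ann(A) = {x ∈ A : xA = Ax = 0}`, as a submodule. -/
def annSubmodule {A : Type*} [AddCommGroup A] [Module ℂ A]
    (m : A →ₗ[ℂ] A →ₗ[ℂ] A) : Submodule ℂ A where
  carrier := {x | ∀ y : A, m x y = 0 ∧ m y x = 0}
  add_mem' := by
    intro a b ha hb
    intro y
    constructor
    · simp [map_add, LinearMap.add_apply, (ha y).1, (hb y).1]
    · simp [map_add, (ha y).2, (hb y).2]
  zero_mem' := by intro y; simp
  smul_mem' := by
    intro c a ha y
    constructor
    · simp [map_smul, LinearMap.smul_apply, (ha y).1]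
    · simp [map_smul, (ha y).2]

/-- A bilinear map vanishing on `N` in both arguments descends to the quotient by `N`. -/
theorem exists_bilinear_quotient_lift {R M P : Type*} [CommRing R] [AddCommGroup M] [Module R M]
    [AddCommGroup P] [Module R P] (N : Submodule R M) (B : M →ₗ[R] M →ₗ[R] P)
    (hB : ∀ x ∈ N, ∀ y, B x y = 0 ∧ B y x = 0) :
    ∃ C : (M ⧸ N) →ₗ[R] (M ⧸ N) →ₗ[R] P, ∀ x y : M,
      C (Submodule.Quotient.mk x) (Submodule.Quotient.mk y) = B x y := by
  let D : M →ₗ[R] (M ⧸ N) →ₗ[R] P :=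
    (N.liftQ B.flip fun x hx => LinearMap.ext fun y => (hB x hx y).2).flip
  have hD (x y : M) : D x (Submodule.Quotient.mk y) = B x y := rfl
  refine ⟨N.liftQ D fun x hx => ?_, hD⟩
  refine LinearMap.ext fun q => ?_
  obtain ⟨y, rfl⟩ := Submodule.Quotient.mk_surjective N q
  exact (hB x hx y).1

/-- An isomorphism `N ≃ V` splits `M` as `(M ⧸ N) × V`, compatibly with the projection to `M ⧸ N`. -/
theorem exists_linearEquiv_quotient_prod {K M V : Type*} [Field K] [AddCommGroup M] [Module K M]
    [AddCommGroup V] [Module K V] (N : Submodule K M) (φ : N ≃ₗ[K] V) :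
    ∃ (π : M →ₗ[K] V) (e : M ≃ₗ[K] (M ⧸ N) × V),
      ∀ x, e x = (Submodule.Quotient.mk x, π x) := by
  obtain ⟨p, hp⟩ := N.subtype.exists_leftInverse_of_injective N.ker_subtype
  have hpN (x : N) : p x = x := LinearMap.congr_fun hp x
  let π : M →ₗ[K] V := φ.toLinearMap ∘ₗ p
  have hπ (x : N) : π x = φ x := congrArg φ (hpN x)
  refine ⟨π, LinearEquiv.ofBijective (N.mkQ.prod π) ⟨?_, ?_⟩, fun x => rfl⟩
  · rw [injective_iff_map_eq_zero]
    intro x hx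
    obtain ⟨hx₁, hx₂⟩ := Prod.mk.inj hx
    have hxN : x ∈ N := (Submodule.Quotient.mk_eq_zero N).1 hx₁
    have h := (hπ ⟨x, hxN⟩).symm.trans hx₂
    exact congrArg Subtype.val (φ.map_eq_zero_iff.1 h)
  · rintro ⟨q, v⟩
    obtain ⟨x, rfl⟩ := Submodule.Quotient.mk_surjective N q
    refine ⟨x + φ.symm (v - π x), Prod.ext ?_ ?_⟩
    · exact (Submodule.Quotient.eq N).2 (by rw [add_sub_cancel_left]; exact Subtype.property _)
    · change π (x + φ.symm (v - π x)) = v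
      rw [map_add, hπ, φ.apply_symm_apply, add_sub_cancel]

/-- If `A` is an `n`-dimensional bicommutative algebra over `ℂ` with
`dim Ann(A) = s ≠ 0`, then `A' = A/Ann(A)` carries an induced bicommutative
multiplication, is `(n-s)`-dimensional, and there is a cocycle
`θ ∈ Z²(A', ℂ^s)` with `Ann(A') ∩ Ann(θ) = 0` such that `A ≅ A'_θ`. -/
theorem quotient_by_annihilator_central_extension
    {A : Type*} [AddCommGroup A] [Module ℂ A] [FiniteDimensional ℂ A]
    (n s : ℕ) (m : A →ₗ[ℂ] A →ₗ[ℂ] A) (hm : IsBicommutative m)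
    (hn : Module.finrank ℂ A = n)
    (hs : Module.finrank ℂ (annSubmodule m) = s) (hs0 : s ≠ 0) :
    ∃ m' : (A ⧸ annSubmodule m) →ₗ[ℂ] (A ⧸ annSubmodule m) →ₗ[ℂ] (A ⧸ annSubmodule m),
      (∀ x y : A,
          m' (Submodule.Quotient.mk x) (Submodule.Quotient.mk y)
            = Submodule.Quotient.mk (m x y)) ∧
      IsBicommutative m' ∧
      Module.finrank ℂ (A ⧸ annSubmodule m) = n - s ∧
      ∃ θ : (A ⧸ annSubmodule m) →ₗ[ℂ] (A ⧸ annSubmodule m) →ₗ[ℂ] (Fin s → ℂ),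
        IsCocycle m' θ ∧
        (∀ x : A ⧸ annSubmodule m,
            (∀ y, m' x y = 0 ∧ m' y x = 0) → (∀ y, θ x y = 0 ∧ θ y x = 0) → x = 0) ∧
        ∃ e : A ≃ₗ[ℂ] (A ⧸ annSubmodule m) × (Fin s → ℂ),
          ∀ x y : A, e (m x y) = extMul m' θ (e x) (e y) := by
  obtain ⟨μ, hμ⟩ := exists_bilinear_quotient_lift (annSubmodule m) m fun x hx => hx
  obtain ⟨π, e, he⟩ := exists_linearEquiv_quotient_prod (annSubmodule m)
    (LinearEquiv.ofFinrankEq (annSubmodule m) (Fin s → ℂ) (by simp [hs]))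
  have mk_surj := Submodule.Quotient.mk_surjective (annSubmodule m)
  let m' := μ.compr₂ (annSubmodule m).mkQ
  let θ := μ.compr₂ π
  have hm' (x y : A) : m' (Submodule.Quotient.mk x) (Submodule.Quotient.mk y)
      = Submodule.Quotient.mk (m x y) := congrArg (annSubmodule m).mkQ (hμ x y)
  have hθ (x y : A) : θ (Submodule.Quotient.mk x) (Submodule.Quotient.mk y) = π (m x y) :=
    congrArg π (hμ x y)
  refine ⟨m', hm', ⟨?_, ?_⟩, ?_, θ, ⟨?_, ?_⟩, ?_, e, ?_⟩
  · intro x y z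
    obtain ⟨x, rfl⟩ := mk_surj x
    obtain ⟨y, rfl⟩ := mk_surj y
    obtain ⟨z, rfl⟩ := mk_surj z
    simp only [hm', hm.1 x y z]
  · intro x y z
    obtain ⟨x, rfl⟩ := mk_surj x
    obtain ⟨y, rfl⟩ := mk_surj y
    obtain ⟨z, rfl⟩ := mk_surj z
    simp only [hm', hm.2 x y z]
  · rw [Submodule.finrank_quotient, hn, hs]
  · intro x y z
    obtain ⟨x, rfl⟩ := mk_surj x
    obtain ⟨y, rfl⟩ := mk_surj y
    obtain ⟨z, rfl⟩ := mk_surj z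
    simp only [hm', hθ, hm.1 x y z]
  · intro x y z
    obtain ⟨x, rfl⟩ := mk_surj x
    obtain ⟨y, rfl⟩ := mk_surj y
    obtain ⟨z, rfl⟩ := mk_surj z
    simp only [hm', hθ, hm.2 x y z]
  · intro x hx hxθ
    obtain ⟨x, rfl⟩ := mk_surj x
    have eq_zero (a : A) (h₁ : (Submodule.Quotient.mk a : A ⧸ annSubmodule m) = 0)
        (h₂ : π a = 0) : a = 0 :=
      e.map_eq_zero_iff.1 ((he a).trans (Prod.ext h₁ h₂))
    refine (Submodule.Quotient.mk_eq_zero _).2 fun y => ⟨eq_zero _ ?_ ?_, eq_zero _ ?_ ?_⟩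
    · exact (hm' x y).symm.trans (hx _).1
    · exact (hθ x y).symm.trans (hxθ _).1
    · exact (hm' y x).symm.trans (hx _).2
    · exact (hθ y x).symm.trans (hxθ _).2
  · intro x y
    rw [he, he, he]
    exact Prod.ext (hm' x y).symm (hθ x y).symm
end

section
/- Let A be a bicommutative algebra over ℂ and V an s-dimensional ℂ-vector space with basis e_1,…,e_s. Let θ, ϑ ∈ Z²(A,V), written θ(x,y) = Σ_{i=1}^s θ_i(x,y)e_i and ϑ(x,y) = Σ_{i=1}^s ϑ_i(x,y)e_i with θ_i, ϑ_i ∈ Z²(A,ℂ). Assume the cohomology classes [θ_1],…,[θ_s] are linearly independent in H²(A,ℂ) and ⋂_{i=1}^s Ann(θ_i) ∩ Ann(A) = 0, and similarly for ϑ. Then A_θ and A_ϑ are isomorphic as ℂ-algebras if and only if there exists an algebra automorphism φ of A such that the span of the classes [θ_1∘(φ×φ)],…,[θ_s∘(φ×φ)] in H²(A,ℂ) equals the span of [ϑ_1],…,[ϑ_s]. -/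
/-- The coboundary map `f ↦ δf = ((x,y) ↦ f(xy))`. -/
noncomputable def cobound {A : Type*} [AddCommGroup A] [Module ℂ A]
    (m : A →ₗ[ℂ] A →ₗ[ℂ] A) : (A →ₗ[ℂ] ℂ) →ₗ[ℂ] (A →ₗ[ℂ] A →ₗ[ℂ] ℂ) where
  toFun f := m.compr₂ f
  map_add' f g := by ext x y; simp [LinearMap.compr₂_apply]
  map_smul' c f := by ext x y; simp [LinearMap.compr₂_apply]

/-- `B²(A,ℂ)`: the space of scalar-valued coboundaries. -/
noncomputable def Bsub {A : Type*} [AddCommGroup A] [Module ℂ A]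
    (m : A →ₗ[ℂ] A →ₗ[ℂ] A) : Submodule ℂ (A →ₗ[ℂ] A →ₗ[ℂ] ℂ) :=
  LinearMap.range (cobound m)

/-- The cohomology class of a bilinear form, i.e. its coset modulo `B²(A,ℂ)`.
(`H²(A,ℂ) = Z²(A,ℂ)/B²(A,ℂ)` is identified with the image of the cocycles in the
quotient of the space of all bilinear forms by `B²(A,ℂ)`.) -/
noncomputable def cls {A : Type*} [AddCommGroup A] [Module ℂ A]
    (m : A →ₗ[ℂ] A →ₗ[ℂ] A) (θ : A →ₗ[ℂ] A →ₗ[ℂ] ℂ) :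
    (A →ₗ[ℂ] A →ₗ[ℂ] ℂ) ⧸ Bsub m :=
  (Bsub m).mkQ θ

/-- Pack a family of scalar cocycles `θ_1,…,θ_s` into a single `ℂ^s`-valued bilinear
map, `θ(x,y) = Σ θ_i(x,y) e_i` in the standard basis of `ℂ^s`. -/
noncomputable def pack {A : Type*} [AddCommGroup A] [Module ℂ A] {s : ℕ}
    (θ : Fin s → (A →ₗ[ℂ] A →ₗ[ℂ] ℂ)) : A →ₗ[ℂ] A →ₗ[ℂ] (Fin s → ℂ) :=
  LinearMap.mk₂ ℂ (fun x y i => θ i x y)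
    (fun x x' y => by funext i; simp)
    (fun c x y => by funext i; simp)
    (fun x y y' => by funext i; simp)
    (fun c x y => by funext i; simp)

/-- Two families related by an invertible matrix have the same span; the converse holds when one
of them is linearly independent. -/
theorem span_range_eq_iff_exists_matrix {ι K E : Type*} [Fintype ι] [DecidableEq ι] [Field K]
    [AddCommGroup E] [Module K E] {a b : ι → E} (hb : LinearIndependent K b) :
    Submodule.span K (Set.range a) = Submodule.span K (Set.range b) ↔
      ∃ M N : Matrix ι ι K, N * M = 1 ∧ ∀ i, a i = ∑ j, M i j • b j := by
  constructor
  · intro h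
    have ha : ∀ i, ∃ c : ι → K, ∑ j, c j • b j = a i := fun i =>
      (Submodule.mem_span_range_iff_exists_fun K).1 (h ▸ Submodule.subset_span ⟨i, rfl⟩)
    have hb' : ∀ i, ∃ c : ι → K, ∑ j, c j • a j = b i := fun i =>
      (Submodule.mem_span_range_iff_exists_fun K).1 (h ▸ Submodule.subset_span ⟨i, rfl⟩)
    choose M hM using ha
    choose N hN using hb'
    refine ⟨Matrix.of M, Matrix.of N, ?_, fun i => (hM i).symm⟩
    have key : ∀ i, ∑ k, (Matrix.of N * Matrix.of M) i k • b k =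
        ∑ k, (1 : Matrix ι ι K) i k • b k := by
      intro i
      simp only [Matrix.one_apply, ite_smul, one_smul, zero_smul, Finset.sum_ite_eq,
        Finset.mem_univ, if_true, Matrix.mul_apply, Matrix.of_apply, Finset.sum_smul, mul_smul]
      rw [Finset.sum_comm, ← hN i]
      exact Finset.sum_congr rfl fun j _ => by rw [← Finset.smul_sum, hM j]
    ext i k
    exact congrFun (hb.fintypeLinearCombination_injective (by
      simpa [Fintype.linearCombination_apply] using key i)) k
  · rintro ⟨M, N, hNM, ha⟩
    apply le_antisymm <;> rw [Submodule.span_le] <;> rintro _ ⟨i, rfl⟩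
    · exact (Submodule.mem_span_range_iff_exists_fun K).2 ⟨M i, (ha i).symm⟩
    · refine (Submodule.mem_span_range_iff_exists_fun K).2 ⟨N i, ?_⟩
      calc ∑ j, N i j • a j = ∑ k, (N * M) i k • b k := by
            simp only [ha, Matrix.mul_apply, Finset.sum_smul, mul_smul, Finset.smul_sum]
            exact Finset.sum_comm
        _ = b i := by simp [hNM, Matrix.one_apply]

section CentralExtension

variable {A V W : Type*} [AddCommGroup A] [Module ℂ A] [AddCommGroup V] [Module ℂ V]
  [AddCommGroup W] [Module ℂ W] {s : ℕ}

theorem extMul_apply (m : A →ₗ[ℂ] A →ₗ[ℂ] A) (θ : A →ₗ[ℂ] A →ₗ[ℂ] V) (p q : A × V) :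
    extMul m θ p q = (m p.1 q.1, θ p.1 q.1) := rfl

/-- If `Ann(θ) ∩ Ann(A) = 0`, then the annihilator of the central extension `A_θ` is `V`. -/
theorem extMul_annihilator_iff {m : A →ₗ[ℂ] A →ₗ[ℂ] A} {θ : A →ₗ[ℂ] A →ₗ[ℂ] V}
    (h : ∀ x, (∀ y, θ x y = 0 ∧ θ y x = 0) → (∀ y, m x y = 0 ∧ m y x = 0) → x = 0) (p : A × V) :
    (∀ q, extMul m θ p q = 0 ∧ extMul m θ q p = 0) ↔ p.1 = 0 := by
  constructor
  · intro hp
    have hp' := fun y : A => hp (y, 0)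
    simp only [extMul_apply, Prod.mk_eq_zero] at hp'
    exact h _ (fun y => ⟨(hp' y).1.2, (hp' y).2.2⟩) fun y => ⟨(hp' y).1.1, (hp' y).2.1⟩
  · intro hp q
    simp [extMul_apply, hp]

/-- A linear equivalence preserving the subspace `V` of `A × V` induces one on `A`. -/
noncomputable def fstEquiv (g : (A × V) ≃ₗ[ℂ] (A × W)) (hg : ∀ p, (g p).1 = 0 ↔ p.1 = 0) :
    A ≃ₗ[ℂ] A :=
  LinearEquiv.ofLinearMap
    (LinearMap.fst ℂ A W ∘ₗ g.toLinearMap ∘ₗ LinearMap.inl ℂ A V)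
    (LinearMap.fst ℂ A V ∘ₗ g.symm.toLinearMap ∘ₗ LinearMap.inl ℂ A W)
    (LinearMap.ext fun x => by
      have h := (hg (((g.symm (x, 0)).1, 0) - g.symm (x, 0))).2 (by simp)
      simpa [sub_eq_zero] using h)
    (LinearMap.ext fun x => by
      have h := (hg (g.symm ((g (x, 0)).1, 0) - (x, 0))).1 (by simp)
      simpa [sub_eq_zero] using h)

theorem fstEquiv_fst (g : (A × V) ≃ₗ[ℂ] (A × W)) (hg : ∀ p, (g p).1 = 0 ↔ p.1 = 0) (p : A × V) :
    fstEquiv g hg p.1 = (g p).1 := by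
  have h := (hg ((p.1, 0) - p)).2 (by simp)
  simpa [sub_eq_zero, fstEquiv] using h

theorem cls_eq_sum_iff (m : A →ₗ[ℂ] A →ₗ[ℂ] A) (η : A →ₗ[ℂ] A →ₗ[ℂ] ℂ)
    (ϑ : Fin s → (A →ₗ[ℂ] A →ₗ[ℂ] ℂ)) (c : Fin s → ℂ) :
    cls m η = ∑ j, c j • cls m (ϑ j) ↔
      ∃ f : A →ₗ[ℂ] ℂ, ∀ x y, η x y = ∑ j, c j * ϑ j x y + f (m x y) := by
  simp only [cls, ← map_smul, ← map_sum]
  rw [← sub_eq_zero, ← map_sub, ← LinearMap.mem_ker, Submodule.ker_mkQ, Bsub, LinearMap.mem_range]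
  refine exists_congr fun f => ?_
  rw [eq_sub_iff_add_eq', eq_comm]
  simp [cobound, LinearMap.ext_iff]

/-- The isomorphisms `A_ϑ ≃ A_θ` in terms of automorphisms of `A` and invertible matrices. -/
theorem exists_extMul_equiv_iff {m : A →ₗ[ℂ] A →ₗ[ℂ] A} {θ ϑ : Fin s → (A →ₗ[ℂ] A →ₗ[ℂ] ℂ)}
    (hθ : ∀ x : A, (∀ i, ∀ y, θ i x y = 0 ∧ θ i y x = 0) →
      (∀ y, m x y = 0 ∧ m y x = 0) → x = 0)
    (hϑ : ∀ x : A, (∀ i, ∀ y, ϑ i x y = 0 ∧ ϑ i y x = 0) →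
      (∀ y, m x y = 0 ∧ m y x = 0) → x = 0) :
    (∃ g : (A × (Fin s → ℂ)) ≃ₗ[ℂ] (A × (Fin s → ℂ)),
        ∀ p q, g (extMul m (pack ϑ) p q) = extMul m (pack θ) (g p) (g q)) ↔
      ∃ φ : A ≃ₗ[ℂ] A, (∀ x y : A, φ (m x y) = m (φ x) (φ y)) ∧
        ∃ M N : Matrix (Fin s) (Fin s) ℂ, N * M = 1 ∧
          ∀ i, cls m ((θ i).compl₁₂ φ.toLinearMap φ.toLinearMap) =
            ∑ j, M i j • cls m (ϑ j) := by
  have pack_ann : ∀ {η : Fin s → (A →ₗ[ℂ] A →ₗ[ℂ] ℂ)}, (∀ x : A,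
      (∀ i, ∀ y, η i x y = 0 ∧ η i y x = 0) → (∀ y, m x y = 0 ∧ m y x = 0) → x = 0) →
      ∀ x, (∀ y, pack η x y = 0 ∧ pack η y x = 0) → (∀ y, m x y = 0 ∧ m y x = 0) → x = 0 :=
    fun h x hx => h x fun i y => ⟨congrFun (hx y).1 i, congrFun (hx y).2 i⟩
  constructor
  · rintro ⟨g, hg⟩
    have hfst : ∀ p, (g p).1 = 0 ↔ p.1 = 0 := by
      intro p
      rw [← extMul_annihilator_iff (pack_ann hθ), ← extMul_annihilator_iff (pack_ann hϑ),
        g.surjective.forall]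
      simp only [← hg, map_eq_zero_iff g g.injective]
    have hsnd : ∀ v, g.symm (0, v) = (0, (g.symm (0, v)).2) := fun v =>
      Prod.ext ((hfst _).1 (by simp)) rfl
    let α : (Fin s → ℂ) →ₗ[ℂ] (Fin s → ℂ) :=
      LinearMap.snd ℂ A _ ∘ₗ g.toLinearMap ∘ₗ LinearMap.inr ℂ A _
    let β : (Fin s → ℂ) →ₗ[ℂ] (Fin s → ℂ) :=
      LinearMap.snd ℂ A _ ∘ₗ g.symm.toLinearMap ∘ₗ LinearMap.inr ℂ A _
    have hαβ : α ∘ₗ β = LinearMap.id := LinearMap.ext fun v => by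
      simp [α, β, ← hsnd]
    refine ⟨fstEquiv g hfst, fun x y => ?_, LinearMap.toMatrix' α, LinearMap.toMatrix' β, ?_,
      fun i => (cls_eq_sum_iff _ _ _ _).2 ⟨LinearMap.proj i ∘ₗ LinearMap.snd ℂ A _ ∘ₗ
        g.toLinearMap ∘ₗ LinearMap.inl ℂ A _, fun x y => ?_⟩⟩
    · have h := congrArg Prod.fst (hg (x, 0) (y, 0))
      rwa [extMul_apply, extMul_apply, ← fstEquiv_fst g hfst, ← fstEquiv_fst g hfst,
        ← fstEquiv_fst g hfst] at h
    · rw [mul_eq_one_comm, ← LinearMap.toMatrix'_comp, hαβ, LinearMap.toMatrix'_id]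
    · have h := congrFun (congrArg Prod.snd (hg (x, 0) (y, 0))) i
      rw [extMul_apply, extMul_apply, ← fstEquiv_fst g hfst, ← fstEquiv_fst g hfst,
        ← zero_add (pack ϑ _ _), ← add_zero (m _ _), ← Prod.mk_add_mk, add_comm, map_add] at h
      have hα : ∑ j, LinearMap.toMatrix' α i j * ϑ j x y = α (pack ϑ x y) i :=
        congrFun (LinearMap.toMatrix'_mulVec α (pack ϑ x y)) i
      rw [hα]
      exact h.symm
  · rintro ⟨φ, hφ, M, N, hNM, h⟩
    simp only [cls_eq_sum_iff] at h
    choose f hf using h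
    refine ⟨φ.skewProd (Matrix.toLin'OfInv hNM (mul_eq_one_comm.1 hNM)) (LinearMap.pi f), fun p q => ?_⟩
    refine Prod.ext (hφ _ _) (funext fun i => ?_)
    simp only [extMul_apply, LinearEquiv.skewProd_apply, Matrix.toLin'OfInv_apply,
      Matrix.toLin'_apply, Pi.add_apply, LinearMap.pi_apply]
    exact (hf i p.1 q.1).symm

end CentralExtension

/-- Two central extensions `A_θ` and `A_ϑ` of a bicommutative algebra `A`
(with cohomologically independent components whose joint annihilator meets `Ann(A)`
trivially) are isomorphic iff some algebra automorphism `φ` of `A` carries the span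
of the classes `[θ_i ∘ (φ × φ)]` onto the span of the classes `[ϑ_i]` in `H²(A,ℂ)`. -/
theorem central_extensions_isomorphic_iff_orbit_eq
    {A : Type*} [AddCommGroup A] [Module ℂ A] (s : ℕ)
    (m : A →ₗ[ℂ] A →ₗ[ℂ] A) (hm : IsBicommutative m)
    (θ ϑ : Fin s → (A →ₗ[ℂ] A →ₗ[ℂ] ℂ))
    (hθ : ∀ i, IsCocycle m (θ i)) (hϑ : ∀ i, IsCocycle m (ϑ i))
    (hθind : LinearIndependent ℂ (fun i => cls m (θ i)))
    (hϑind : LinearIndependent ℂ (fun i => cls m (ϑ i)))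
    (hθann : ∀ x : A, (∀ i, ∀ y, θ i x y = 0 ∧ θ i y x = 0) →
      (∀ y, m x y = 0 ∧ m y x = 0) → x = 0)
    (hϑann : ∀ x : A, (∀ i, ∀ y, ϑ i x y = 0 ∧ ϑ i y x = 0) →
      (∀ y, m x y = 0 ∧ m y x = 0) → x = 0) :
    (∃ e : (A × (Fin s → ℂ)) ≃ₗ[ℂ] (A × (Fin s → ℂ)),
        ∀ p q, e (extMul m (pack θ) p q) = extMul m (pack ϑ) (e p) (e q)) ↔
      ∃ φ : A ≃ₗ[ℂ] A, (∀ x y : A, φ (m x y) = m (φ x) (φ y)) ∧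
        Submodule.span ℂ
            (Set.range fun i => cls m ((θ i).compl₁₂ φ.toLinearMap φ.toLinearMap)) =
          Submodule.span ℂ (Set.range fun i => cls m (ϑ i)) := by
  simp only [span_range_eq_iff_exists_matrix hϑind]
  rw [← exists_extMul_equiv_iff hθann hϑann]
  constructor
  all_goals
    rintro ⟨e, he⟩
    exact ⟨e.symm, fun p q => by rw [LinearEquiv.symm_apply_eq, he]; simp⟩
end

section
/- Let N_01 be the 4-dimensional ℂ-algebra with basis e_1,e_2,e_3,e_4 and multiplication determined by e_1e_1 = e_2 (all other products of basis vectors zero). A bijective linear map φ : N_01 → N_01 is an algebra automorphism of N_01 if and only if there exist scalars x,q,w,z,r,u,t,k,y,l ∈ ℂ with x ≠ 0 and tl − ky ≠ 0 such that φ(e_1) = x e_1 + q e_2 + w e_3 + z e_4, φ(e_2) = x² e_2, φ(e_3) = r e_2 + t e_3 + y e_4, and φ(e_4) = u e_2 + k e_3 + l e_4. -/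
/-- The elementary bilinear multiplication on `ℂ^n` sending `(x, y)` to
`(x_i * y_j) • e_k`; concrete algebras below are sums of such terms. -/
noncomputable def T {n : ℕ} (i j k : Fin n) :
    (Fin n → ℂ) →ₗ[ℂ] (Fin n → ℂ) →ₗ[ℂ] (Fin n → ℂ) :=
  LinearMap.mk₂ ℂ (fun x y => (x i * y j) • (Pi.single k 1 : Fin n → ℂ))
    (fun x x' y => by simp [add_mul, add_smul])
    (fun c x y => by simp [smul_eq_mul, smul_smul, mul_assoc])
    (fun x y y' => by simp [mul_add, add_smul])
    (fun c x y => by simp [smul_eq_mul, smul_smul, mul_left_comm])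

/-- The standard basis vector `e_{i+1}` of `ℂ^4` (`i : Fin 4` is 0-indexed). -/
noncomputable def e (i : Fin 4) : Fin 4 → ℂ := Pi.single i 1

/-- The algebra `N_01`: `e_1 e_1 = e_2`, all other products of basis vectors zero. -/
noncomputable def mulN01 : (Fin 4 → ℂ) →ₗ[ℂ] (Fin 4 → ℂ) →ₗ[ℂ] (Fin 4 → ℂ) := T 0 0 1

theorem mulN01_apply (a b : Fin 4 → ℂ) : mulN01 a b = (a 0 * b 0) • e 1 := rfl

theorem eq_sum_smul_e (a : Fin 4 → ℂ) :
    a = a 0 • e 0 + a 1 • e 1 + a 2 • e 2 + a 3 • e 3 := by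
  ext i
  fin_cases i <;> simp [e]

/-- Description of the automorphism group of `N_01`: a bijective linear map `φ` is an
algebra automorphism of `N_01` iff it has the stated matrix form with `x ≠ 0` and
`t·l − k·y ≠ 0`. -/
theorem automorphisms_of_N01 (φ : (Fin 4 → ℂ) ≃ₗ[ℂ] (Fin 4 → ℂ)) :
    (∀ a b : Fin 4 → ℂ, φ (mulN01 a b) = mulN01 (φ a) (φ b)) ↔
      ∃ x q w z r u t k y l : ℂ, x ≠ 0 ∧ t * l - k * y ≠ 0 ∧
        φ (e 0) = x • e 0 + q • e 1 + w • e 2 + z • e 3 ∧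
        φ (e 1) = (x ^ 2) • e 1 ∧
        φ (e 2) = r • e 1 + t • e 2 + y • e 3 ∧
        φ (e 3) = u • e 1 + k • e 2 + l • e 3 := by
  constructor
  · intro h
    have h1 : φ (e 1) = (φ (e 0) 0 ^ 2) • e 1 := by
      simpa [mulN01_apply, e, sq] using h (e 0) (e 0)
    have he1 : e 1 ≠ 0 := by simp [e]
    have hx : φ (e 0) 0 ≠ 0 := by
      intro h0
      rw [h0] at h1
      exact he1 (φ.map_eq_zero_iff.mp (by simpa using h1))
    have h2 : φ (e 2) 0 = 0 := by
      simpa [mulN01_apply, e] using (congrFun (h (e 2) (e 2)) 1).symm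
    have h3 : φ (e 3) 0 = 0 := by
      simpa [mulN01_apply, e] using (congrFun (h (e 3) (e 3)) 1).symm
    have key : ∀ α β : ℂ, α * φ (e 2) 2 + β * φ (e 3) 2 = 0 →
        α * φ (e 2) 3 + β * φ (e 3) 3 = 0 → α = 0 ∧ β = 0 := by
      intro α β hk hl
      have hj : α * φ (e 2) 0 + β * φ (e 3) 0 = 0 := by simp [h2, h3]
      have hφ : φ (α • e 2 + β • e 3) =
          φ (((α * φ (e 2) 1 + β * φ (e 3) 1) / φ (e 0) 0 ^ 2) • e 1) := by
        rw [map_smul, h1, smul_smul, div_mul_cancel₀ _ (pow_ne_zero 2 hx), map_add, map_smul,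
          map_smul]
        ext i
        fin_cases i
        · simpa [e] using hj
        · simp [e]
        · simpa [e] using hk
        · simpa [e] using hl
      have hv := φ.injective hφ
      exact ⟨by simpa [e] using congrFun hv 2, by simpa [e] using congrFun hv 3⟩
    refine ⟨φ (e 0) 0, φ (e 0) 1, φ (e 0) 2, φ (e 0) 3, φ (e 2) 1, φ (e 3) 1, φ (e 2) 2,
      φ (e 3) 2, φ (e 2) 3, φ (e 3) 3, hx, ?_, eq_sum_smul_e _, h1, ?_, ?_⟩
    · intro hdet
      obtain ⟨hl, hy⟩ := key (φ (e 3) 3) (-φ (e 2) 3) (by linear_combination hdet) (by ring)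
      obtain ⟨hk, ht⟩ := key (φ (e 3) 2) (-φ (e 2) 2) (by ring) (by linear_combination -hdet)
      rw [neg_eq_zero] at hy ht
      exact one_ne_zero (key 1 0 (by simp [ht]) (by simp [hy])).1
    · simpa [h2] using eq_sum_smul_e (φ (e 2))
    · simpa [h3] using eq_sum_smul_e (φ (e 3))
  · rintro ⟨x, q, w, z, r, u, t, k, y, l, -, -, h0, h1, h2, h3⟩ a b
    have hφ : ∀ a : Fin 4 → ℂ, φ a 0 = a 0 * x := by
      intro a
      conv_lhs => rw [eq_sum_smul_e a]
      simp only [map_add, map_smul, h0, h1, h2, h3]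
      simp [e]
    rw [mulN01_apply, mulN01_apply, map_smul, h1, hφ, hφ, smul_smul]
    congr 1
    ring
end

section
/- Let N_07 be the 4-dimensional ℂ-algebra with basis e_1,e_2,e_3,e_4 and multiplication determined by e_1e_2 = e_3, e_2e_1 = e_4, e_2e_2 = −e_3 (all other products of basis vectors zero). A bijective linear map φ : N_07 → N_07 is an algebra automorphism of N_07 if and only if there exist scalars x,z,u,t,v ∈ ℂ with x ≠ 0 such that φ(e_1) = x e_1 + z e_3 + t e_4, φ(e_2) = x e_2 + u e_3 + v e_4, φ(e_3) = x² e_3, and φ(e_4) = x² e_4. -/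
/-- The algebra `N_07`: `e_1 e_2 = e_3`, `e_2 e_1 = e_4`, `e_2 e_2 = -e_3`,
all other products of basis vectors zero. -/
noncomputable def mulN07 : (Fin 4 → ℂ) →ₗ[ℂ] (Fin 4 → ℂ) →ₗ[ℂ] (Fin 4 → ℂ) :=
  T 0 1 2 - T 1 1 2 + T 1 0 3

theorem e_apply (i j : Fin 4) : e i j = if j = i then 1 else 0 :=
  Pi.single_apply i 1 j

theorem mulN07_apply (a b : Fin 4 → ℂ) :
    mulN07 a b = ![0, 0, a 0 * b 1 - a 1 * b 1, a 1 * b 0] := by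
  ext i
  fin_cases i <;> simp [mulN07, T]

theorem mulN07_eq_smul_e (a b : Fin 4 → ℂ) :
    mulN07 a b = (a 0 * b 1 - a 1 * b 1) • e 2 + (a 1 * b 0) • e 3 := by
  rw [eq_sum_smul_e (mulN07 a b)]
  simp [mulN07_apply]

/-- Description of the automorphism group of `N_07`: a bijective linear map `φ` is an
algebra automorphism of `N_07` iff it has the stated matrix form with `x ≠ 0`. -/
theorem automorphisms_of_N07 (φ : (Fin 4 → ℂ) ≃ₗ[ℂ] (Fin 4 → ℂ)) :
    (∀ a b : Fin 4 → ℂ, φ (mulN07 a b) = mulN07 (φ a) (φ b)) ↔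
      ∃ x z u t v : ℂ, x ≠ 0 ∧
        φ (e 0) = x • e 0 + z • e 2 + t • e 3 ∧
        φ (e 1) = x • e 1 + u • e 2 + v • e 3 ∧
        φ (e 2) = (x ^ 2) • e 2 ∧
        φ (e 3) = (x ^ 2) • e 3 := by
  constructor
  · intro h
    have h00 : 0 = mulN07 (φ (e 0)) (φ (e 0)) := by
      rw [← h, mulN07_eq_smul_e]; simp [e]
    have h01 : φ (e 2) = mulN07 (φ (e 0)) (φ (e 1)) := by
      rw [← h, mulN07_eq_smul_e]; simp [e]
    have h10 : φ (e 3) = mulN07 (φ (e 1)) (φ (e 0)) := by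
      rw [← h, mulN07_eq_smul_e]; simp [e]
    have h11 : -φ (e 2) = mulN07 (φ (e 1)) (φ (e 1)) := by
      rw [← h, mulN07_eq_smul_e, ← map_neg]; simp [e]
    have he2 : φ (e 2) ≠ 0 := by simp [e]
    have hp1 : φ (e 0) 1 = 0 := by
      have h2 := congrFun h00 2
      have h3 := congrFun h00 3
      simp [mulN07_apply] at h2 h3
      grind
    have hφ2 : φ (e 2) = (φ (e 0) 0 * φ (e 1) 1) • e 2 := by
      rw [h01, mulN07_eq_smul_e, hp1]; simp
    have hφ3 : φ (e 3) = (φ (e 1) 1 * φ (e 0) 0) • e 3 := by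
      rw [h10, mulN07_eq_smul_e, hp1]; simp
    have hne : φ (e 0) 0 * φ (e 1) 1 ≠ 0 := by
      intro h0
      rw [h0, zero_smul] at hφ2
      exact he2 hφ2
    have hp0 : φ (e 0) 0 ≠ 0 := left_ne_zero_of_mul hne
    have hq1 : φ (e 1) 1 ≠ 0 := right_ne_zero_of_mul hne
    rw [hφ2] at h11
    have hq0 : φ (e 1) 0 = 0 := by
      have h3 := congrFun h11 3
      simpa [e_apply, mulN07_apply, hq1] using h3.symm
    have heq : φ (e 1) 1 = φ (e 0) 0 := by
      have h2 := congrFun h11 2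
      simp [e_apply, mulN07_apply, hq0] at h2
      exact (h2.resolve_right hq1).symm
    refine ⟨φ (e 0) 0, φ (e 0) 2, φ (e 1) 2, φ (e 0) 3, φ (e 1) 3, hp0, ?_, ?_, ?_, ?_⟩
    · simpa [hp1] using eq_sum_smul_e (φ (e 0))
    · simpa [hq0, heq] using eq_sum_smul_e (φ (e 1))
    · rw [hφ2, heq, sq]
    · rw [hφ3, heq, sq]
  · rintro ⟨x, z, u, t, v, -, h0, h1, h2, h3⟩ a b
    have key (c : Fin 4 → ℂ) : φ c 0 = x * c 0 ∧ φ c 1 = x * c 1 := by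
      rw [eq_sum_smul_e c]
      simp only [map_add, map_smul, h0, h1, h2, h3]
      simp [e, mul_comm]
    rw [mulN07_eq_smul_e a b, mulN07_eq_smul_e (φ a) (φ b)]
    simp only [map_add, map_smul, h2, h3, key, smul_smul]
    congr 2 <;> ring
end

section
/- Let N_01 be the 4-dimensional ℂ-algebra with basis e_1,e_2,e_3,e_4 and only nonzero basis product e_1e_1 = e_2. Each of the ten bilinear forms Δ₁₂+Δ₂₁, Δ₁₃+Δ₃₁, Δ₁₄+Δ₄₁, Δ₃₃, Δ₃₄+Δ₄₃, Δ₄₄, Δ₂₁, Δ₃₁, Δ₄₁, Δ₄₃ is a cocycle on N_01, and their cosets modulo B²(N_01,ℂ) form a basis of H²(N_01,ℂ); in particular dim H²(N_01,ℂ) = 10. -/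
/-- The bilinear form `Δ_{ij}` on `ℂ^n` (0-indexed): `Δ_{ij}(x,y) = x_i y_j`,
so that `Δ_{ij}(e_l, e_m) = δ_{il} δ_{jm}`. -/
noncomputable def D {n : ℕ} (i j : Fin n) :
    (Fin n → ℂ) →ₗ[ℂ] (Fin n → ℂ) →ₗ[ℂ] ℂ :=
  LinearMap.mk₂ ℂ (fun x y => x i * y j)
    (fun x x' y => by simp [add_mul])
    (fun c x y => by simp [mul_assoc])
    (fun x y y' => by simp [mul_add])
    (fun c x y => by simp [smul_eq_mul, mul_left_comm])

/-- `Z²(A,ℂ)`: the space of scalar-valued cocycles. -/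
noncomputable def Zsub {A : Type*} [AddCommGroup A] [Module ℂ A]
    (m : A →ₗ[ℂ] A →ₗ[ℂ] A) : Submodule ℂ (A →ₗ[ℂ] A →ₗ[ℂ] ℂ) where
  carrier := {θ | IsCocycle m θ}
  add_mem' := by
    rintro θ η ⟨h1, h2⟩ ⟨g1, g2⟩
    refine ⟨fun x y z => ?_, fun x y z => ?_⟩
    · simp only [LinearMap.add_apply]
      rw [h1 x y z, g1 x y z]
    · simp only [LinearMap.add_apply]
      rw [h2 x y z, g2 x y z]
  zero_mem' := ⟨fun x y z => by simp, fun x y z => by simp⟩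
  smul_mem' := by
    rintro c θ ⟨h1, h2⟩
    refine ⟨fun x y z => ?_, fun x y z => ?_⟩
    · simp only [LinearMap.smul_apply]
      rw [h1 x y z]
    · simp only [LinearMap.smul_apply]
      rw [h2 x y z]

/-- `H²(A,ℂ) = Z²(A,ℂ)/B²(A,ℂ)`, realized as the image of the cocycles in the
quotient of the space of all bilinear forms by the coboundaries. -/
noncomputable def H2 {A : Type*} [AddCommGroup A] [Module ℂ A]
    (m : A →ₗ[ℂ] A →ₗ[ℂ] A) : Submodule ℂ ((A →ₗ[ℂ] A →ₗ[ℂ] ℂ) ⧸ Bsub m) :=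
  (Zsub m).map (Bsub m).mkQ

/-- The algebra `N_01` on `ℂ^4`: `e_1 e_1 = e_2` (other basis products zero). -/
noncomputable def mul : (Fin 4 → ℂ) →ₗ[ℂ] (Fin 4 → ℂ) →ₗ[ℂ] (Fin 4 → ℂ) :=
  T 0 0 1

/-- The forms `Δ₁₂+Δ₂₁, Δ₁₃+Δ₃₁, Δ₁₄+Δ₄₁, Δ₃₃, Δ₃₄+Δ₄₃, Δ₄₄, Δ₂₁, Δ₃₁, Δ₄₁, Δ₄₃` (0-indexed). -/
noncomputable def forms : Fin 10 → ((Fin 4 → ℂ) →ₗ[ℂ] (Fin 4 → ℂ) →ₗ[ℂ] ℂ) :=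
  ![D 0 1 + D 1 0, D 0 2 + D 2 0, D 0 3 + D 3 0, D 2 2, D 2 3 + D 3 2, D 3 3,
    D 1 0, D 2 0, D 3 0, D 3 2]

@[simp]
lemma D_apply {n : ℕ} (i j : Fin n) (x y : Fin n → ℂ) : D i j x y = x i * y j := rfl

@[simp]
lemma mul_apply_eq_smul (x y : Fin 4 → ℂ) :
    mul x y = (x 0 * y 0) • (Pi.single 1 1 : Fin 4 → ℂ) := rfl

@[simp]
lemma cobound_apply {A : Type*} [AddCommGroup A] [Module ℂ A] (m : A →ₗ[ℂ] A →ₗ[ℂ] A)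
    (f : A →ₗ[ℂ] ℂ) (x y : A) : cobound m f x y = f (m x y) := rfl

lemma forms_isCocycle (i : Fin 10) : IsCocycle mul (forms i) := by
  fin_cases i <;> constructor <;> intro x y z <;> simp [forms] <;> ring

lemma sum_smul_forms_apply (g : Fin 10 → ℂ) (x y : Fin 4 → ℂ) :
    (∑ i, g i • forms i) x y =
      g 0 * (x 0 * y 1 + x 1 * y 0) + g 1 * (x 0 * y 2 + x 2 * y 0) +
      g 2 * (x 0 * y 3 + x 3 * y 0) + g 3 * (x 2 * y 2) +
      g 4 * (x 2 * y 3 + x 3 * y 2) + g 5 * (x 3 * y 3) + g 6 * (x 1 * y 0) +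
      g 7 * (x 2 * y 0) + g 8 * (x 3 * y 0) + g 9 * (x 3 * y 2) := by
  simp [Fin.sum_univ_succ, forms]
  ring

lemma sum_smul_cls {A ι : Type*} [AddCommGroup A] [Module ℂ A] [Fintype ι]
    (m : A →ₗ[ℂ] A →ₗ[ℂ] A) (g : ι → ℂ) (θ : ι → A →ₗ[ℂ] A →ₗ[ℂ] ℂ) :
    ∑ i, g i • cls m (θ i) = cls m (∑ i, g i • θ i) := by
  simp only [cls, map_sum, map_smul]

lemma linearIndependent_cls_forms : LinearIndependent ℂ fun i => cls mul (forms i) := by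
  rw [Fintype.linearIndependent_iff]
  intro g hg
  rw [sum_smul_cls, cls, Submodule.mkQ_apply, Submodule.Quotient.mk_eq_zero] at hg
  obtain ⟨f, hf⟩ := hg
  have key (i j : Fin 4) := LinearMap.congr_fun₂ hf (Pi.single i 1) (Pi.single j 1)
  simp only [sum_smul_forms_apply, cobound_apply, mul_apply_eq_smul] at key
  have h01 := key 0 1
  have h10 := key 1 0
  have h02 := key 0 2
  have h20 := key 2 0
  have h03 := key 0 3
  have h30 := key 3 0
  have h22 := key 2 2
  have h23 := key 2 3
  have h32 := key 3 2
  have h33 := key 3 3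
  simp at h01 h10 h02 h20 h03 h30 h22 h23 h32 h33
  intro i
  fin_cases i <;> simp <;> grind

/-- Every cocycle on `N_01` is a combination of the listed forms up to a coboundary. -/
lemma IsCocycle.exists_eq_sum_add_cobound {θ : (Fin 4 → ℂ) →ₗ[ℂ] (Fin 4 → ℂ) →ₗ[ℂ] ℂ}
    (h : IsCocycle mul θ) :
    ∃ (g : Fin 10 → ℂ) (f : (Fin 4 → ℂ) →ₗ[ℂ] ℂ), θ = ∑ i, g i • forms i + cobound mul f := by
  have left (j : Fin 4) (hj : j ≠ 0) : θ (Pi.single 1 1) (Pi.single j 1) = 0 := by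
    simpa [hj.symm] using h.1 (Pi.single 0 1) (Pi.single 0 1) (Pi.single j 1)
  have right (j : Fin 4) (hj : j ≠ 0) : θ (Pi.single j 1) (Pi.single 1 1) = 0 := by
    simpa [hj.symm] using h.2 (Pi.single j 1) (Pi.single 0 1) (Pi.single 0 1)
  set t : Fin 4 → Fin 4 → ℂ := fun i j => θ (Pi.single i 1) (Pi.single j 1) with ht
  refine ⟨![t 0 1, t 0 2, t 0 3, t 2 2, t 2 3, t 3 3, t 1 0 - t 0 1, t 2 0 - t 0 2,
    t 3 0 - t 0 3, t 3 2 - t 2 3], t 0 0 • LinearMap.proj 1, ?_⟩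
  refine (Pi.basisFun ℂ (Fin 4)).ext fun i => (Pi.basisFun ℂ (Fin 4)).ext fun j => ?_
  rw [LinearMap.add_apply, LinearMap.add_apply, sum_smul_forms_apply]
  fin_cases i <;> fin_cases j <;> simp [ht, left, right]

lemma span_cls_forms :
    Submodule.span ℂ (Set.range fun i => cls mul (forms i)) = H2 mul := by
  apply le_antisymm
  · rw [Submodule.span_le]
    rintro _ ⟨i, rfl⟩
    exact Submodule.mem_map_of_mem (forms_isCocycle i)
  · rintro _ ⟨θ, hθ, rfl⟩
    obtain ⟨g, f, rfl⟩ := IsCocycle.exists_eq_sum_add_cobound hθ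
    have hf : (Bsub mul).mkQ (cobound mul f) = 0 :=
      (Submodule.Quotient.mk_eq_zero _).2 ⟨f, rfl⟩
    rw [map_add, hf, add_zero, ← cls, ← sum_smul_cls]
    exact Submodule.sum_mem _ fun i _ =>
      Submodule.smul_mem _ _ (Submodule.subset_span ⟨i, rfl⟩)

/-- The listed forms are cocycles, their cosets modulo `B²` form a basis of `H²`,
and in particular `dim H² = 10`. -/
theorem secondCohomology_N01 :
    (∀ i, IsCocycle mul (forms i)) ∧
    LinearIndependent ℂ (fun i => cls mul (forms i)) ∧
    Submodule.span ℂ (Set.range fun i => cls mul (forms i)) = H2 mul ∧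
    Module.finrank ℂ (H2 mul) = 10 := by
  refine ⟨forms_isCocycle, linearIndependent_cls_forms, span_cls_forms, ?_⟩
  rw [← span_cls_forms, finrank_span_eq_card linearIndependent_cls_forms, Fintype.card_fin]
end

section
/- For α, β ∈ ℂ, let B₁₆^{α,β} be the 5-dimensional ℂ-algebra with basis e_1,…,e_5 and only nonzero basis products e_1e_1 = e_3, e_2e_2 = e_4, e_1e_3 = α e_5, e_3e_1 = (α+1) e_5, e_2e_4 = β e_5, e_4e_2 = (β+1) e_5. Then for all α, β ∈ ℂ, the algebras B₁₆^{α,β} and B₁₆^{β,α} are isomorphic as ℂ-algebras. -/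
/-- The algebra `B₁₆^{α,β}` on `ℂ^5`: `e_1 e_1 = e_3`, `e_2 e_2 = e_4`,
`e_1 e_3 = α e_5`, `e_3 e_1 = (α+1) e_5`, `e_2 e_4 = β e_5`, `e_4 e_2 = (β+1) e_5`. -/
noncomputable def mulB16 (α β : ℂ) :
    (Fin 5 → ℂ) →ₗ[ℂ] (Fin 5 → ℂ) →ₗ[ℂ] (Fin 5 → ℂ) :=
  T 0 0 2 + T 1 1 3 + α • T 0 2 4 + (α + 1) • T 2 0 4 + β • T 1 3 4 + (β + 1) • T 3 1 4

/-- Relabelling the coordinates by a permutation carries the elementary multiplication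
`T (σ i) (σ j) (σ k)` to `T i j k`. -/
lemma funCongrLeft_T {n : ℕ} (σ : Equiv.Perm (Fin n)) (i j k : Fin n) (x y : Fin n → ℂ) :
    LinearEquiv.funCongrLeft ℂ ℂ σ (T (σ i) (σ j) (σ k) x y) =
      T i j k (LinearEquiv.funCongrLeft ℂ ℂ σ x) (LinearEquiv.funCongrLeft ℂ ℂ σ y) := by
  ext l
  simp [T, LinearEquiv.funCongrLeft_apply, LinearMap.funLeft_apply, Pi.single_apply]

/-- For all `α, β ∈ ℂ`, the algebras `B₁₆^{α,β}` and `B₁₆^{β,α}` are isomorphic. -/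
theorem B16_swap_isomorphic (α β : ℂ) :
    ∃ φ : (Fin 5 → ℂ) ≃ₗ[ℂ] (Fin 5 → ℂ),
      ∀ x y : Fin 5 → ℂ, φ (mulB16 α β x y) = mulB16 β α (φ x) (φ y) := by
  let σ : Equiv.Perm (Fin 5) := Equiv.swap 0 1 * Equiv.swap 2 3
  refine ⟨LinearEquiv.funCongrLeft ℂ ℂ σ, fun x y => ?_⟩
  have h0 : σ 0 = 1 := by decide
  have h1 : σ 1 = 0 := by decide
  have h2 : σ 2 = 3 := by decide
  have h3 : σ 3 = 2 := by decide
  have h4 : σ 4 = 4 := by decide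
  simp only [mulB16, LinearMap.add_apply, LinearMap.smul_apply, map_add, map_smul,
    ← funCongrLeft_T, h0, h1, h2, h3, h4]
  abel
end
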